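/- Let A, B ∈ F_2^m satisfy supp(B) ⊊ supp(A) and |B| ≥ 1, let D = Δ_A \ Δ_B, and let u ∈ F_2^m. Then the Hamming weight of the codeword c_u = (u·g)_{g ∈ D} equals 2^{|A|−1}(1 − χ(u|A)) − 2^{|B|−1}(1 − χ(u|B)). -/

import Mathlib

open Finset

def supp {m : ℕ} (v : Fin m → ZMod 2) : Finset (Fin m) :=
  Finset.univ.filter fun i => v i ≠ 0

def wt {m : ℕ} (v : Fin m → ZMod 2) : ℕ := (supp v).card

def delta {m : ℕ} (A : Fin m → ZMod 2) : Finset (Fin m → ZMod 2) :=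
  Finset.univ.filter fun v => supp v ⊆ supp A

def deltaT {m : ℕ} (T : Finset (Fin m)) : Finset (Fin m → ZMod 2) :=
  Finset.univ.filter fun v => supp v ⊆ T

def hwt {ι : Type*} [Fintype ι] (c : ι → ZMod 2) : ℕ :=
  (Finset.univ.filter fun i => c i ≠ 0).card

def cw {m : ℕ} (D : Finset (Fin m → ZMod 2)) (u : Fin m → ZMod 2) : ↥D → ZMod 2 :=
  fun g => ∑ i, u i * (g : Fin m → ZMod 2) i

def codeC {m : ℕ} (D : Finset (Fin m → ZMod 2)) :
    Submodule (ZMod 2) (↥D → ZMod 2) :=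
  LinearMap.range (Matrix.mulVecLin (Matrix.of fun (g : ↥D) (i : Fin m) => (g : Fin m → ZMod 2) i))

def dualCode {ι : Type*} [Fintype ι] (C : Submodule (ZMod 2) (ι → ZMod 2)) :
    Submodule (ZMod 2) (ι → ZMod 2) where
  carrier := {w | ∀ c ∈ C, ∑ i, w i * c i = 0}
  zero_mem' := by simp
  add_mem' := by
    intro a b ha hb c hc
    have h := congrArg₂ (· + ·) (ha c hc) (hb c hc)
    simpa [add_mul, Finset.sum_add_distrib] using h
  smul_mem' := by
    intro r w hw c hc
    have h := congrArg (r * ·) (hw c hc)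
    simpa [Finset.mul_sum, mul_assoc] using h

def isMinDist {ι : Type*} [Fintype ι] (C : Set (ι → ZMod 2)) (d : ℕ) : Prop :=
  (∃ c ∈ C, c ≠ 0 ∧ hwt c = d) ∧ ∀ c ∈ C, c ≠ 0 → d ≤ hwt c

def chi {m : ℕ} (u v : Fin m → ZMod 2) : ℤ :=
  if supp u ∩ supp v = ∅ then 1 else 0

theorem mem_supp {m : ℕ} {v : Fin m → ZMod 2} {i : Fin m} : i ∈ supp v ↔ v i ≠ 0 := by
  simp [supp]

theorem mem_delta {m : ℕ} {A v : Fin m → ZMod 2} : v ∈ delta A ↔ supp v ⊆ supp A := by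
  simp [delta]

theorem supp_injective {m : ℕ} : Function.Injective (supp : (Fin m → ZMod 2) → Finset (Fin m)) := by
  intro v w h
  funext i
  have hi : v i ≠ 0 ↔ w i ≠ 0 := by rw [← mem_supp, ← mem_supp, h]
  revert hi
  generalize v i = a
  generalize w i = b
  revert a b
  decide

theorem card_delta {m : ℕ} (A : Fin m → ZMod 2) : (delta A).card = 2 ^ wt A := by
  rw [wt, ← Finset.card_powerset, ← Finset.card_image_of_injective _ supp_injective]
  congr 1
  ext S
  simp only [Finset.mem_image, mem_delta, Finset.mem_powerset]
  constructor
  · rintro ⟨v, hv, rfl⟩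
    exact hv
  · intro hS
    have h : supp (fun i => if i ∈ S then (1 : ZMod 2) else 0) = S := by
      ext i
      simp [mem_supp]
    exact ⟨_, h.symm ▸ hS, h⟩

theorem add_single_mem_delta {m : ℕ} {A v : Fin m → ZMod 2} {i : Fin m} (hi : i ∈ supp A)
    (hv : v ∈ delta A) : v + Pi.single i 1 ∈ delta A := by
  rw [mem_delta] at hv ⊢
  intro j hj
  rcases eq_or_ne j i with rfl | hne
  · exact hi
  · apply hv
    simpa [mem_supp, Pi.single_eq_of_ne hne] using hj

theorem add_single_add_single {m : ℕ} (v : Fin m → ZMod 2) (i : Fin m) :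
    v + Pi.single i 1 + Pi.single i 1 = v := by
  rw [add_assoc, ← Pi.single_add, CharTwo.add_self_eq_zero, Pi.single_zero, add_zero]

theorem sum_mul_add_single {m : ℕ} (u v : Fin m → ZMod 2) (i : Fin m) :
    ∑ j, u j * (v + Pi.single i 1 : Fin m → ZMod 2) j = (∑ j, u j * v j) + u i := by
  simp [mul_add, Finset.sum_add_distrib, Pi.single_apply]

theorem card_filter_delta_of_mem {m : ℕ} {A u : Fin m → ZMod 2} {i : Fin m} (hu : i ∈ supp u)
    (hA : i ∈ supp A) :
    ((delta A).filter fun v => ∑ j, u j * v j ≠ 0).card = 2 ^ (wt A - 1) := by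
  have hui : u i = 1 := Fin.eq_one_of_ne_zero _ (mem_supp.1 hu)
  have hflip : ∀ a : ZMod 2, a + 1 = 0 ↔ a ≠ 0 := by decide
  have heq : ((delta A).filter fun v => ∑ j, u j * v j ≠ 0).card
      = ((delta A).filter fun v => ¬ ∑ j, u j * v j ≠ 0).card := by
    refine Finset.card_nbij' (· + Pi.single i 1) (· + Pi.single i 1) ?_ ?_ ?_ ?_
    · intro v hv
      simp only [Finset.coe_filter, Set.mem_ofPred_eq] at hv ⊢
      refine ⟨add_single_mem_delta hA hv.1, ?_⟩
      rw [sum_mul_add_single, hui, not_not, hflip]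
      exact hv.2
    · intro v hv
      simp only [Finset.coe_filter, Set.mem_ofPred_eq] at hv ⊢
      refine ⟨add_single_mem_delta hA hv.1, ?_⟩
      rw [sum_mul_add_single, hui, ne_eq, hflip]
      exact hv.2
    · exact fun v _ => add_single_add_single v i
    · exact fun v _ => add_single_add_single v i
  have hsum := Finset.card_filter_add_card_filter_not (s := delta A)
    (fun v => ∑ j, u j * v j ≠ 0)
  have hpos : 0 < wt A := Finset.card_pos.2 ⟨i, hA⟩
  have hpow : 2 ^ wt A = 2 * 2 ^ (wt A - 1) := by
    rw [← pow_succ', Nat.sub_add_cancel hpos]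
  rw [card_delta] at hsum
  omega

theorem card_filter_delta {m : ℕ} (A u : Fin m → ZMod 2) :
    (((delta A).filter fun v => ∑ j, u j * v j ≠ 0).card : ℤ)
      = 2 ^ (wt A - 1) * (1 - chi u A) := by
  rcases (supp u ∩ supp A).eq_empty_or_nonempty with h | ⟨i, hi⟩
  · have hzero : ((delta A).filter fun v => ∑ j, u j * v j ≠ 0) = ∅ := by
      refine Finset.filter_eq_empty_iff.2 fun v hv => not_not.2 (Finset.sum_eq_zero fun j _ => ?_)
      by_contra hj
      have hmem : j ∈ supp u ∩ supp A := Finset.mem_inter.2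
        ⟨mem_supp.2 (left_ne_zero_of_mul hj),
          mem_delta.1 hv (mem_supp.2 (right_ne_zero_of_mul hj))⟩
      simp [h] at hmem
    simp [hzero, chi, h]
  · have hne : supp u ∩ supp A ≠ ∅ := Finset.ne_empty_of_mem hi
    rw [Finset.mem_inter] at hi
    rw [card_filter_delta_of_mem hi.1 hi.2]
    simp [chi, hne]

theorem hwt_cw {m : ℕ} (D : Finset (Fin m → ZMod 2)) (u : Fin m → ZMod 2) :
    hwt (cw D u) = (D.filter fun v => ∑ j, u j * v j ≠ 0).card := by
  rw [hwt, Finset.card_filter, Finset.card_filter]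
  exact Finset.sum_coe_sort D fun v => if ∑ j, u j * v j ≠ 0 then 1 else 0

theorem stmt14 {m : ℕ} (A B : Fin m → ZMod 2) (hBA : supp B ⊂ supp A) (hB : 1 ≤ wt B)
    (D : Finset (Fin m → ZMod 2)) (hD : D = delta A \ delta B)
    (u : Fin m → ZMod 2) :
    (hwt (cw D u) : ℤ)
      = 2 ^ (wt A - 1) * (1 - chi u A) - 2 ^ (wt B - 1) * (1 - chi u B) := by
  have hsub : delta B ⊆ delta A := fun v hv =>
    mem_delta.2 ((mem_delta.1 hv).trans hBA.subset)
  have hsplit := Finset.card_sdiff_add_card_eq_card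
    (Finset.filter_subset_filter (fun v => ∑ j, u j * v j ≠ 0) hsub)
  have hfilter : (delta A).filter (fun v => ∑ j, u j * v j ≠ 0) \
      (delta B).filter (fun v => ∑ j, u j * v j ≠ 0) = D.filter fun v => ∑ j, u j * v j ≠ 0 := by
    ext v
    simp only [hD, Finset.mem_sdiff, Finset.mem_filter]
    tauto
  rw [hfilter, ← hwt_cw] at hsplit
  rw [← card_filter_delta, ← card_filter_delta]
  omega
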